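/- Let f, g : S → ℂ satisfy the integral Kannappan-sine addition law ∫_S f(xσ(y)t) dμ(t) = f(x)g(y) + f(y)g(x) for all x, y ∈ S, with ∫_S f(t) dμ(t) = 0 and f, g linearly independent over ℂ. Then ∫_S ∫_S f(ts) dμ(s)dμ(t) = ∫_S ∫_S f(σ(t)s) dμ(s)dμ(t) = ∫_S ∫_S f(sσ(t)) dμ(t)dμ(s). -/

import Mathlib

/-- Integral of `h` against a finitely supported complex measure `μ` on `S`:
`∫_S h(t) dμ(t) = Σ_t μ(t) h(t)`. -/
noncomputable def mint {S : Type*} (μ : S →₀ ℂ) (h : S → ℂ) : ℂ :=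
  μ.sum fun t c => c * h t

theorem mint_add {S : Type*} (μ : S →₀ ℂ) (h k : S → ℂ) :
    mint μ (fun t => h t + k t) = mint μ h + mint μ k := by
  simp only [mint, Finsupp.sum, mul_add, Finset.sum_add_distrib]

theorem mint_const_mul {S : Type*} (μ : S →₀ ℂ) (a : ℂ) (h : S → ℂ) :
    mint μ (fun t => a * h t) = a * mint μ h := by
  simp only [mint, Finsupp.sum, Finset.mul_sum]
  exact Finset.sum_congr rfl fun _ _ => by ring

theorem mint_mul_const {S : Type*} (μ : S →₀ ℂ) (h : S → ℂ) (a : ℂ) :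
    mint μ (fun t => h t * a) = mint μ h * a := by
  simp only [mul_comm _ a, mint_const_mul]

theorem mint_comm {S : Type*} (μ : S →₀ ℂ) (h : S → S → ℂ) :
    mint μ (fun t => mint μ (fun s => h t s)) = mint μ (fun s => mint μ (fun t => h t s)) := by
  simp only [mint, Finsupp.sum, Finset.mul_sum]
  rw [Finset.sum_comm]
  exact Finset.sum_congr rfl fun _ _ => Finset.sum_congr rfl fun _ _ => by ring

theorem stmt_14 {S : Type*} [Semigroup S] (σ : S → S)
    (hσmul : ∀ x y : S, σ (x * y) = σ x * σ y) (hσinv : ∀ x : S, σ (σ x) = x)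
    (μ : S →₀ ℂ) (f g : S → ℂ)
    (hf : ∀ x y : S, mint μ (fun t => f (x * σ y * t)) = f x * g y + f y * g x)
    (hf0 : mint μ f = 0)
    (hli : ∀ a b : ℂ, (∀ x : S, a * f x + b * g x = 0) → a = 0 ∧ b = 0) :
    mint μ (fun t => mint μ (fun s => f (t * s)))
        = mint μ (fun t => mint μ (fun s => f (σ t * s)))
      ∧ mint μ (fun t => mint μ (fun s => f (σ t * s)))
        = mint μ (fun s => mint μ (fun t => f (s * σ t))) := by
  have key (x y : S) : f (x * σ y) * mint μ g
      = f x * mint μ (fun t => g (y * t)) + mint μ (fun t => f (y * t)) * g x := by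
    have h₁ : mint μ (fun s => mint μ (fun t => f (x * σ y * σ s * t)))
        = f (x * σ y) * mint μ g := by
      simp only [hf, mint_add, mint_const_mul, mint_mul_const, hf0, zero_mul, add_zero]
    have h₂ : mint μ (fun s => mint μ (fun t => f (x * σ y * σ s * t)))
        = f x * mint μ (fun t => g (y * t)) + mint μ (fun t => f (y * t)) * g x := by
      have assoc (s : S) : x * σ y * σ s = x * σ (y * s) := by rw [hσmul, mul_assoc]
      simp only [assoc, hf, mint_add, mint_const_mul, mint_mul_const]
    rw [← h₁, h₂]
  have hg0 : mint μ g ≠ 0 := by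
    intro hg
    have hF (y : S) : mint μ (fun t => f (y * t)) = 0 :=
      (hli _ _ fun x => by
        have := key x y
        rw [hg, mul_zero, mul_comm (f x)] at this
        exact this.symm).2
    have hfz (y : S) : f y = 0 :=
      (hli (g y) (f y) fun x => by
        rw [mul_comm (g y), ← hf, hF]).2
    exact one_ne_zero (hli 1 0 fun x => by simp [hfz]).1
  have swap (y : S) : mint μ (fun s => f (s * σ y)) = mint μ (fun t => f (y * t)) := by
    apply mul_right_cancel₀ hg0
    rw [← mint_mul_const]
    simp only [key, mint_add, mint_const_mul, mint_mul_const, hf0, zero_mul, zero_add]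
  have h₁ : mint μ (fun t => mint μ (fun s => f (t * s)))
      = mint μ (fun t => mint μ (fun s => f (σ t * s))) := by
    simp only [← swap (σ _), hσinv]
    exact mint_comm μ fun t s => f (t * s)
  refine ⟨h₁, h₁.symm.trans ?_⟩
  rw [mint_comm μ fun s t => f (s * σ t)]
  simp only [swap]
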